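/- arXiv:1406.2837 — 5 statements merged into one kernel-verified Lean document; each statement's English description precedes it below -/
import Mathlib

section
/- Let P > 0. With u(x) = tanh(Px), C = (ε − √(ε² + 4P²))/(2P), u_ε(x) = −(1/C) tanh(Px) and x_ε = (1/(2P)) ln((1 − C)/(1 + C)) for ε > 0, the following hold: for every fixed x ≥ 0, u_ε(x) → u(x) as ε → 0⁺, and x_ε → ∞ as ε → 0⁺. -/
open Set Filter Real

/-- As `ε → 0⁺`, the solution `u_ε` of the free boundary formulation of the nonlinear
problem converges pointwise on `[0, ∞)` to the solution `u x = tanh (P x)` of the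
original problem, and the free boundary `x_ε` tends to infinity. -/
theorem nonlinear_fbf_convergence
    (P : ℝ) (hP : 0 < P)
    (u : ℝ → ℝ) (hu : ∀ x : ℝ, u x = Real.tanh (P * x))
    (C : ℝ → ℝ)
    (hC : ∀ ε : ℝ, C ε = (ε - Real.sqrt (ε ^ 2 + 4 * P ^ 2)) / (2 * P))
    (uε : ℝ → ℝ → ℝ)
    (huε : ∀ ε x : ℝ, uε ε x = -(1 / C ε) * Real.tanh (P * x))
    (xε : ℝ → ℝ)
    (hxε : ∀ ε : ℝ, xε ε = (1 / (2 * P)) * Real.log ((1 - C ε) / (1 + C ε))) :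
    (∀ x : ℝ, 0 ≤ x →
      Tendsto (fun ε : ℝ => uε ε x) (nhdsWithin 0 (Ioi 0)) (nhds (u x))) ∧
    Tendsto xε (nhdsWithin 0 (Ioi 0)) atTop := by
  have hC0 : Tendsto C (nhdsWithin 0 (Ioi 0)) (nhds (-1)) := by
    have hcont : Continuous C := by
      rw [funext hC]
      fun_prop
    have hval : C 0 = -1 := by
      have hsqrt : Real.sqrt (0 ^ 2 + 4 * P ^ 2) = 2 * P := by
        rw [show (0 : ℝ) ^ 2 + 4 * P ^ 2 = (2 * P) ^ 2 by ring]
        exact Real.sqrt_sq (by positivity)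
      rw [hC, hsqrt]
      field_simp
      ring
    simpa only [hval] using (hcont.tendsto 0).mono_left nhdsWithin_le_nhds
  refine ⟨fun x _ => ?_, ?_⟩
  · simp only [huε, hu]
    have h := ((hC0.inv₀ (by norm_num)).neg).mul_const (Real.tanh (P * x))
    simpa using h
  · have hpos : ∀ ε ∈ Ioi (0 : ℝ), 0 < 1 + C ε := by
      intro ε hε
      have hε' : 0 < ε := hε
      have hsqrt : Real.sqrt (ε ^ 2 + 4 * P ^ 2) < ε + 2 * P := by
        rw [Real.sqrt_lt' (by positivity)]
        nlinarith [mul_pos hε' hP]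
      have hsum : 1 + C ε = (ε + 2 * P - Real.sqrt (ε ^ 2 + 4 * P ^ 2)) / (2 * P) := by
        rw [hC]
        field_simp
        ring
      rw [hsum]
      exact div_pos (by linarith) (by positivity)
    have hden : Tendsto (fun ε => 1 + C ε) (nhdsWithin 0 (Ioi 0)) (nhdsWithin 0 (Ioi 0)) := by
      refine tendsto_nhdsWithin_iff.2 ⟨?_, eventually_nhdsWithin_of_forall hpos⟩
      simpa using hC0.const_add 1
    have hnum : Tendsto (fun ε => 1 - C ε) (nhdsWithin 0 (Ioi 0)) (nhds (1 - -1)) :=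
      hC0.const_sub 1
    have hquot := hnum.pos_mul_atTop (by norm_num) hden.inv_tendsto_nhdsGT_zero
    rw [funext hxε]
    exact (Real.tendsto_log_atTop.comp hquot).const_mul_atTop (by positivity)
end

section
/- Let P > 0 and ε > 0, and set C = (ε − √(ε² + 4P²))/(2P), u(x) = tanh(Px), u_ε(x) = −(1/C) tanh(Px), x_ε = (1/(2P)) ln((1 − C)/(1 + C)). Then u_ε(x) − u(x) = (−1/C − 1) tanh(Px) ≥ 0 for x ≥ 0, the maximum of |u_ε(x) − u(x)| over x ∈ [0, x_ε] equals 1 + C = (2P + ε − √(ε² + 4P²))/(2P), and this maximum tends to 0 as ε → 0⁺; hence u_ε converges to u uniformly on the free boundary domains as ε → 0⁺. -/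
open Set Filter Real

theorem Real.tanh_monotone : Monotone Real.tanh := by
  intro x y hxy
  by_contra! h
  have := artanh_lt_artanh (neg_one_lt_tanh y) (tanh_lt_one x) h
  rw [artanh_tanh, artanh_tanh] at this
  linarith

/-- For the nonlinear example: `u_ε x - u x = (-1/C - 1) tanh (P x) ≥ 0` for `x ≥ 0`,
the maximum of `|u_ε - u|` over `[0, x_ε]` equals `1 + C = (2P + ε - √(ε²+4P²))/(2P)`,
this maximum tends to `0` as `ε → 0⁺`, and hence `u_ε` converges to `u` uniformly on
the free boundary domains as `ε → 0⁺`. -/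
theorem nonlinear_fbf_error_bound
    (P : ℝ) (hP : 0 < P)
    (u : ℝ → ℝ) (hu : ∀ x : ℝ, u x = Real.tanh (P * x))
    (C : ℝ → ℝ)
    (hC : ∀ ε : ℝ, C ε = (ε - Real.sqrt (ε ^ 2 + 4 * P ^ 2)) / (2 * P))
    (uε : ℝ → ℝ → ℝ)
    (huε : ∀ ε x : ℝ, uε ε x = -(1 / C ε) * Real.tanh (P * x))
    (xε : ℝ → ℝ)
    (hxε : ∀ ε : ℝ, xε ε = (1 / (2 * P)) * Real.log ((1 - C ε) / (1 + C ε))) :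
    (∀ ε : ℝ, 0 < ε → ∀ x : ℝ, 0 ≤ x →
      uε ε x - u x = (-(1 / C ε) - 1) * Real.tanh (P * x) ∧ 0 ≤ uε ε x - u x) ∧
    (∀ ε : ℝ, 0 < ε →
      IsGreatest ((fun x => |uε ε x - u x|) '' Icc 0 (xε ε)) (1 + C ε) ∧
      1 + C ε = (2 * P + ε - Real.sqrt (ε ^ 2 + 4 * P ^ 2)) / (2 * P)) ∧
    Tendsto (fun ε : ℝ => 1 + C ε) (nhdsWithin 0 (Ioi 0)) (nhds 0) ∧
    (∀ η : ℝ, 0 < η → ∃ δ : ℝ, 0 < δ ∧ ∀ ε : ℝ, 0 < ε → ε < δ →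
      ∀ x ∈ Icc 0 (xε ε), |uε ε x - u x| ≤ η) := by
  have C_mem : ∀ ε : ℝ, 0 < ε → -1 < C ε ∧ C ε < 0 := by
    intro ε hε
    rw [hC, lt_div_iff₀ (by positivity), div_lt_iff₀ (by positivity)]
    have lower : ε < √(ε ^ 2 + 4 * P ^ 2) := Real.lt_sqrt_of_sq_lt (by nlinarith)
    have upper : √(ε ^ 2 + 4 * P ^ 2) < ε + 2 * P := by
      rw [Real.sqrt_lt' (by positivity)]
      nlinarith [mul_pos hε hP]
    constructor <;> linarith
  have coeff_nonneg : ∀ ε : ℝ, 0 < ε → 0 ≤ -(1 / C ε) - 1 := by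
    intro ε hε
    obtain ⟨h₁, h₀⟩ := C_mem ε hε
    have : -(1 / C ε) - 1 = (1 + C ε) / -C ε := by
      have hne := h₀.ne
      field_simp
      ring
    rw [this]
    exact div_nonneg (by linarith) (by linarith)
  have diff_eq : ∀ ε x : ℝ, uε ε x - u x = (-(1 / C ε) - 1) * Real.tanh (P * x) := by
    intro ε x
    rw [huε, hu]
    ring
  have diff_nonneg : ∀ ε : ℝ, 0 < ε → ∀ x : ℝ, 0 ≤ x → 0 ≤ uε ε x - u x := by
    intro ε hε x hx
    rw [diff_eq]
    refine mul_nonneg (coeff_nonneg ε hε) ?_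
    simpa using Real.tanh_monotone (mul_nonneg hP.le hx)
  have P_mul_xε : ∀ ε : ℝ, 0 < ε → P * xε ε = artanh (-C ε) := by
    intro ε hε
    obtain ⟨h₁, h₀⟩ := C_mem ε hε
    rw [hxε, artanh_eq_half_log ⟨by linarith, by linarith⟩, sub_neg_eq_add, ← sub_eq_add_neg]
    field_simp
  have tanh_xε : ∀ ε : ℝ, 0 < ε → Real.tanh (P * xε ε) = -C ε := by
    intro ε hε
    obtain ⟨h₁, h₀⟩ := C_mem ε hε
    rw [P_mul_xε ε hε, tanh_artanh ⟨by linarith, by linarith⟩]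
  have xε_nonneg : ∀ ε : ℝ, 0 < ε → 0 ≤ xε ε := by
    intro ε hε
    refine nonneg_of_mul_nonneg_right ?_ hP
    rw [P_mul_xε ε hε]
    exact artanh_nonneg (by linarith [(C_mem ε hε).2])
  have diff_xε : ∀ ε : ℝ, 0 < ε → uε ε (xε ε) - u (xε ε) = 1 + C ε := by
    intro ε hε
    have h₀ := (C_mem ε hε).2.ne
    rw [diff_eq, tanh_xε ε hε]
    field_simp
    ring
  have abs_diff_le : ∀ ε : ℝ, 0 < ε → ∀ x ∈ Icc 0 (xε ε), |uε ε x - u x| ≤ 1 + C ε := by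
    intro ε hε x hx
    rw [abs_of_nonneg (diff_nonneg ε hε x hx.1), ← diff_xε ε hε, diff_eq, diff_eq]
    exact mul_le_mul_of_nonneg_left
      (Real.tanh_monotone (mul_le_mul_of_nonneg_left hx.2 hP.le)) (coeff_nonneg ε hε)
  have error_tendsto : Tendsto (fun ε : ℝ => 1 + C ε) (nhdsWithin 0 (Ioi 0)) (nhds 0) := by
    have hcont : Continuous fun ε : ℝ => 1 + C ε := by
      simp only [hC]
      fun_prop
    have hzero : 1 + C 0 = 0 := by
      rw [hC, show (0 : ℝ) ^ 2 + 4 * P ^ 2 = (2 * P) ^ 2 by ring, Real.sqrt_sq (by positivity)]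
      field_simp
      ring
    simpa only [hzero] using (hcont.tendsto 0).mono_left nhdsWithin_le_nhds
  refine ⟨fun ε hε x hx => ⟨diff_eq ε x, diff_nonneg ε hε x hx⟩, fun ε hε => ⟨⟨?_, ?_⟩, ?_⟩,
    error_tendsto, fun η hη => ?_⟩
  · refine ⟨xε ε, ⟨xε_nonneg ε hε, le_rfl⟩, ?_⟩
    simp only [diff_xε ε hε]
    exact abs_of_pos (by linarith [(C_mem ε hε).1])
  · rintro _ ⟨x, hx, rfl⟩
    exact abs_diff_le ε hε x hx
  · rw [hC]
    field_simp
    ring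
  · obtain ⟨δ, hδ, hsub⟩ :=
      mem_nhdsGT_iff_exists_Ioo_subset.mp (error_tendsto.eventually (gt_mem_nhds hη))
    exact ⟨δ, hδ, fun ε hε hεδ x hx => (abs_diff_le ε hε x hx).trans (hsub ⟨hε, hεδ⟩).le⟩
end

section
/- Let P > 0 and ε > 0, and set C = (ε − √(ε² + 4P²))/(2P) and u_ε(x) = −(1/C) tanh(Px). Then the missing initial condition of the free boundary formulation is u_ε'(0) = −P/C, and u_ε'(0) → P as ε → 0⁺, i.e. it converges to the missing initial condition u'(0) = P of the original problem. -/
open Set Filter Real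

theorem hasDerivAt_tanh_zero : HasDerivAt Real.tanh 1 0 := by
  have h := (Real.hasDerivAt_sinh 0).div (Real.hasDerivAt_cosh 0) (Real.cosh_pos 0).ne'
  have hfun : Real.tanh = Real.sinh / Real.cosh := by
    funext x
    simp [Real.tanh_eq_sinh_div_cosh]
  rw [hfun]
  simpa using h

theorem hasDerivAt_tanh_const_mul_zero (a : ℝ) :
    HasDerivAt (fun x : ℝ => Real.tanh (a * x)) a 0 := by
  have hlin : HasDerivAt (fun x : ℝ => a * x) a 0 := by
    simpa using (hasDerivAt_id (0 : ℝ)).const_mul a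
  have htanh : HasDerivAt Real.tanh 1 (a * 0) := by
    simpa using hasDerivAt_tanh_zero
  simpa [Function.comp_def] using htanh.comp (0 : ℝ) hlin

/-- For the nonlinear example, the missing initial condition of the free boundary
formulation is `u_ε' 0 = -P/C`, and it converges, as `ε → 0⁺`, to the missing initial
condition `u' 0 = P` of the original problem. -/
theorem nonlinear_fbf_missing_initial_condition
    (P : ℝ) (hP : 0 < P)
    (C : ℝ → ℝ)
    (hC : ∀ ε : ℝ, C ε = (ε - Real.sqrt (ε ^ 2 + 4 * P ^ 2)) / (2 * P))
    (uε : ℝ → ℝ → ℝ)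
    (huε : ∀ ε x : ℝ, uε ε x = -(1 / C ε) * Real.tanh (P * x)) :
    (∀ ε : ℝ, 0 < ε → deriv (uε ε) 0 = -P / C ε) ∧
    Tendsto (fun ε : ℝ => deriv (uε ε) 0) (nhdsWithin 0 (Ioi 0)) (nhds P) ∧
    deriv (fun x : ℝ => Real.tanh (P * x)) 0 = P := by
  have hderiv : ∀ ε : ℝ, deriv (uε ε) 0 = -P / C ε := by
    intro ε
    rw [funext (huε ε), ((hasDerivAt_tanh_const_mul_zero P).const_mul _).deriv]
    ring
  refine ⟨fun ε _ => hderiv ε, ?_, (hasDerivAt_tanh_const_mul_zero P).deriv⟩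
  have hC_zero : C 0 = -1 := by
    have hsqrt : Real.sqrt (0 ^ 2 + 4 * P ^ 2) = 2 * P := by
      rw [show (0 : ℝ) ^ 2 + 4 * P ^ 2 = (2 * P) ^ 2 by ring]
      exact Real.sqrt_sq (by positivity)
    rw [hC, hsqrt]
    field_simp
    ring
  have hC_cont : Continuous C := by
    rw [funext hC]
    fun_prop
  have hlim : Tendsto (fun ε : ℝ => -P / C ε) (nhds 0) (nhds (-P / C 0)) :=
    tendsto_const_nhds.div (hC_cont.tendsto 0) (by norm_num [hC_zero])
  simp only [hderiv]
  simpa [hC_zero] using hlim.mono_left nhdsWithin_le_nhds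
end

section
/- Let Ω : ℝ × ℝ → ℝ, ω ∈ ℝ, μ ∈ ℝ, and let u : ℝ → ℝ be twice differentiable with u''(x) = u(x) · Ω(u(x) e^{−ωx}, u'(x) e^{−ωx}) for all x. Define u*(x*) = e^{ωμ} u(x* − μ). Then u* satisfies the same equation: (u*)''(x*) = u*(x*) · Ω(u*(x*) e^{−ωx*}, (u*)'(x*) e^{−ωx*}) for all x*. Moreover, if u(s) = β e^{ωs} and u'(s) = γ e^{ωs}, then with s* = s + μ one has u*(s*) = β e^{ωs*} and (u*)'(s*) = γ e^{ωs*}; i.e. the governing equation and the two free boundary conditions are invariant under the spiral group x* = x + μ, s* = s + μ, u* = e^{ωμ} u. -/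
open Set Filter Real

theorem deriv_const_mul_comp_sub (c μ : ℝ) (f : ℝ → ℝ) :
    deriv (fun x => c * f (x - μ)) = fun x => c * deriv f (x - μ) := by
  ext x
  rw [deriv_const_mul_field, deriv_comp_sub_const]

/-- Invariance under the spiral group `x* = x + μ`, `s* = s + μ`, `u* = e^{ωμ} u`:
if `u` satisfies `u'' = u Ω(u e^{-ωx}, u' e^{-ωx})` then so does
`u* x* = e^{ωμ} u (x* - μ)`, and the two free boundary conditions
`u s = β e^{ωs}`, `u' s = γ e^{ωs}` are carried to `s* = s + μ`. -/
theorem spiral_group_invariance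
    (Ω : ℝ × ℝ → ℝ) (ω μ : ℝ)
    (u : ℝ → ℝ)
    (hu : ∀ x : ℝ, DifferentiableAt ℝ u x)
    (hu' : ∀ x : ℝ, DifferentiableAt ℝ (deriv u) x)
    (heq : ∀ x : ℝ, deriv (deriv u) x =
      u x * Ω (u x * Real.exp (-ω * x), deriv u x * Real.exp (-ω * x)))
    (ustar : ℝ → ℝ)
    (hustar : ∀ xstar : ℝ, ustar xstar = Real.exp (ω * μ) * u (xstar - μ)) :
    (∀ xstar : ℝ, deriv (deriv ustar) xstar =
      ustar xstar * Ω (ustar xstar * Real.exp (-ω * xstar),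
        deriv ustar xstar * Real.exp (-ω * xstar))) ∧
    (∀ s β γ : ℝ, u s = β * Real.exp (ω * s) → deriv u s = γ * Real.exp (ω * s) →
      ustar (s + μ) = β * Real.exp (ω * (s + μ)) ∧
      deriv ustar (s + μ) = γ * Real.exp (ω * (s + μ))) := by
  have hscale (v : ℝ) (x : ℝ) :
      Real.exp (ω * μ) * v * Real.exp (-ω * x) = v * Real.exp (-ω * (x - μ)) := by
    rw [show -ω * (x - μ) = ω * μ + -ω * x by ring, Real.exp_add]
    ring
  obtain rfl : ustar = fun x => Real.exp (ω * μ) * u (x - μ) := funext hustar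
  simp only [deriv_const_mul_comp_sub]
  refine ⟨fun x => ?_, fun s β γ hs hs' => ?_⟩
  · rw [heq, hscale, hscale, mul_assoc]
  · simp only [add_sub_cancel_right, hs, hs', mul_add, Real.exp_add]
    constructor <;> ring
end

section
/- Let Φ : ℝ × ℝ → ℝ, δ ≠ 0, β ≠ 0, v₀ ∈ ℝ and s* > 0. Suppose u* : ℝ → ℝ is twice differentiable, u*(x*) > 0 for x* ∈ (0, s*], satisfies (u*)''(x*) = u*(x*)^{1−2δ} · Φ(x* · u*(x*)^{−δ}, (u*)'(x*) · u*(x*)^{δ−1}) for all x* ∈ (0, s*], with u*(0) = 0 and (u*)'(0) = v₀, and suppose λ := u*(s*)/β > 0. Set s = λ^{−δ} s* and u(x) = λ^{−1} u*(λ^{δ} x). Then s > 0, u(x) > 0 for x ∈ (0, s], u solves the free boundary value problem u''(x) = u(x)^{1−2δ} · Φ(x · u(x)^{−δ}, u'(x) · u(x)^{δ−1}) for x ∈ (0, s] with u(0) = 0 and u(s) = β, and moreover u'(s) = λ^{δ−1} (u*)'(s*) and u'(0) = λ^{δ−1} v₀. -/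
open Set Filter Real

/-- Derivative of the rescaled function `x ↦ c * f (k * x)`. -/
theorem deriv_const_mul_comp_mul_left (f : ℝ → ℝ) (c k : ℝ) :
    deriv (fun x => c * f (k * x)) = fun x => c * k * deriv f (k * x) := by
  funext x
  rw [deriv_const_mul_field, deriv_comp_mul_left, smul_eq_mul, mul_assoc]

/-- Correctness of the non-iterative transformation method based on the scaling group:
solve the auxiliary IVP `u*'' = u*^{1-2δ} Φ(x* u*^{-δ}, u*' u*^{δ-1})` on `[0, s*]`
with `u* 0 = 0`, `(u*)' 0 = v₀`; with `λ = u*(s*)/β > 0`, `s = λ^{-δ} s*` and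
`u x = λ^{-1} u*(λ^δ x)`, the function `u` solves the free boundary problem with
`u 0 = 0`, `u s = β`, and `u' s = λ^{δ-1} (u*)'(s*)`, `u' 0 = λ^{δ-1} v₀`. -/
theorem scaling_nonITM_correctness
    (Φ : ℝ × ℝ → ℝ) (δ β v₀ sstar : ℝ) (hδ : δ ≠ 0) (hβ : β ≠ 0) (hsstar : 0 < sstar)
    (ustar : ℝ → ℝ)
    (hud : ∀ x : ℝ, DifferentiableAt ℝ ustar x)
    (hud' : ∀ x : ℝ, DifferentiableAt ℝ (deriv ustar) x)
    (hupos : ∀ xstar ∈ Ioc 0 sstar, 0 < ustar xstar)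
    (heq : ∀ xstar ∈ Ioc 0 sstar, deriv (deriv ustar) xstar =
      ustar xstar ^ (1 - 2 * δ) *
        Φ (xstar * ustar xstar ^ (-δ), deriv ustar xstar * ustar xstar ^ (δ - 1)))
    (hu0 : ustar 0 = 0)
    (hu0' : deriv ustar 0 = v₀)
    (lam : ℝ) (hlamdef : lam = ustar sstar / β) (hlam : 0 < lam)
    (s : ℝ) (hs : s = lam ^ (-δ) * sstar)
    (u : ℝ → ℝ) (hudef : ∀ x : ℝ, u x = lam⁻¹ * ustar (lam ^ δ * x)) :
    0 < s ∧
    (∀ x ∈ Ioc 0 s, 0 < u x) ∧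
    (∀ x ∈ Ioc 0 s, deriv (deriv u) x =
      u x ^ (1 - 2 * δ) * Φ (x * u x ^ (-δ), deriv u x * u x ^ (δ - 1))) ∧
    u 0 = 0 ∧
    u s = β ∧
    deriv u s = lam ^ (δ - 1) * deriv ustar sstar ∧
    deriv u 0 = lam ^ (δ - 1) * v₀ := by
  obtain rfl : u = fun x => lam⁻¹ * ustar (lam ^ δ * x) := funext hudef
  have hk : 0 < lam ^ δ := rpow_pos_of_pos hlam δ
  have hk_inv : lam ^ (-δ) = (lam ^ δ)⁻¹ := rpow_neg hlam.le δ
  have hks : lam ^ δ * s = sstar := by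
    rw [hs, hk_inv, mul_inv_cancel_left₀ hk.ne']
  have hk_sub : lam ^ (δ - 1) = lam⁻¹ * lam ^ δ := by
    rw [rpow_sub_one hlam.ne', div_eq_inv_mul]
  have hmem : ∀ x ∈ Ioc 0 s, lam ^ δ * x ∈ Ioc 0 sstar := fun x hx =>
    ⟨mul_pos hk hx.1, hks ▸ mul_le_mul_of_nonneg_left hx.2 hk.le⟩
  have hderiv := deriv_const_mul_comp_mul_left ustar lam⁻¹ (lam ^ δ)
  have hderiv2 := deriv_const_mul_comp_mul_left (deriv ustar) (lam⁻¹ * lam ^ δ) (lam ^ δ)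
  refine ⟨?_, fun x hx => ?_, fun x hx => ?_, ?_, ?_, ?_, ?_⟩
  · rw [hs]
    exact mul_pos (rpow_pos_of_pos hlam _) hsstar
  · exact mul_pos (inv_pos.2 hlam) (hupos _ (hmem x hx))
  · have hw := (hupos _ (hmem x hx)).le
    have hli := (inv_pos.2 hlam).le
    have hpow : lam ^ (1 - 2 * δ) = lam * (lam ^ δ)⁻¹ ^ 2 := by
      rw [rpow_sub hlam, rpow_one, mul_comm 2 δ, rpow_mul hlam.le, rpow_two, inv_pow,
        div_eq_mul_inv]
    simp only [hderiv, hderiv2]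
    rw [heq _ (hmem x hx), mul_rpow hli hw, mul_rpow hli hw, mul_rpow hli hw,
      inv_rpow hlam.le, inv_rpow hlam.le, inv_rpow hlam.le, hpow, hk_inv, hk_sub]
    have hfst : x * ((lam ^ δ)⁻¹⁻¹ * ustar (lam ^ δ * x) ^ (-δ)) =
        lam ^ δ * x * ustar (lam ^ δ * x) ^ (-δ) := by
      rw [inv_inv]
      ring
    have hsnd : lam⁻¹ * lam ^ δ * deriv ustar (lam ^ δ * x) *
        ((lam⁻¹ * lam ^ δ)⁻¹ * ustar (lam ^ δ * x) ^ (δ - 1)) =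
        deriv ustar (lam ^ δ * x) * ustar (lam ^ δ * x) ^ (δ - 1) := by
      field_simp
    rw [hfst, hsnd]
    field_simp
  · simp [hu0]
  · have hne : ustar sstar ≠ 0 := (hupos sstar ⟨hsstar, le_rfl⟩).ne'
    simp only [hks]
    rw [hlamdef]
    field_simp
  · simp only [hderiv, hks, hk_sub]
  · simp only [hderiv, mul_zero, hu0', hk_sub]
end
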